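/- Let F : ℝ² → ℝ² be a fixed-point-free orientation-preserving homeomorphism of the plane (a Brouwer homeomorphism). Then for every x ∈ ℝ², the forward orbit { Fⁿ(x) : n ∈ ℕ } has no accumulation point in ℝ²; in particular F has no recurrent points. -/

import Mathlib

open Set Filter Topology

noncomputable section

/-- The real plane. -/
abbrev Plane : Type := EuclideanSpace ℝ (Fin 2)

/-- `f` restricted to `X` is a homeomorphism onto its image `Y`
(for compact `X`, a continuous injection is a homeomorphism onto its image). -/
def IsHomeoOnto (f : Plane → Plane) (X Y : Set Plane) : Prop :=
  ContinuousOn f X ∧ Set.InjOn f X ∧ f '' X = Y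

/-- `f : X → f(X)` is isotopic to the identity on `X`: there is a continuous family
of homeomorphisms (continuous injections, `X` being compact in applications)
`h_t : X → h_t(X)`, `t ∈ [0,1]`, with `h_0 = id_X` and `h_1 = f`. -/
def IsotopicToIdOn (f : Plane → Plane) (X : Set Plane) : Prop :=
  ∃ H : ℝ → Plane → Plane,
    ContinuousOn (fun p : ℝ × Plane => H p.1 p.2) (Set.Icc (0:ℝ) 1 ×ˢ X) ∧
    (∀ x ∈ X, H 0 x = x) ∧
    (∀ x ∈ X, H 1 x = f x) ∧
    (∀ t ∈ Set.Icc (0:ℝ) 1, Set.InjOn (H t) X)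

/-- A Jordan domain: a subset of the plane homeomorphic to the closed unit disk. -/
def IsJordanDomain (D : Set Plane) : Prop :=
  Nonempty (↥D ≃ₜ ↥(Metric.closedBall (0:Plane) 1))

/-- A self-homeomorphism of the plane is orientation-preserving iff it is isotopic to
the identity through homeomorphisms of the plane (note that a continuous bijection of the
plane is automatically a homeomorphism, by invariance of domain). -/
def IsOrientationPreservingPlaneHomeo (F : Plane ≃ₜ Plane) : Prop :=
  ∃ H : ℝ → Plane → Plane,
    Continuous (fun p : ℝ × Plane => H p.1 p.2) ∧
    (∀ x, H 0 x = x) ∧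
    (∀ x, H 1 x = F x) ∧
    (∀ t ∈ Set.Icc (0:ℝ) 1, Function.Bijective (H t))

/-- A homeomorphism between planar sets (here: the restriction of `f` to `X`) is
orientation-preserving if it extends to an orientation-preserving homeomorphism of the plane. -/
def OrientationPreservingOn (f : Plane → Plane) (X : Set Plane) : Prop :=
  ∃ F : Plane ≃ₜ Plane, IsOrientationPreservingPlaneHomeo F ∧ Set.EqOn f (⇑F) X

/-- A Jordan curve: the image of a topological embedding of the circle
(a continuous injection of the compact circle, hence an embedding). -/
def IsJordanCurve (C : Set Plane) : Prop :=
  ∃ γ : Plane → Plane, ContinuousOn γ (Metric.sphere (0:Plane) 1) ∧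
    Set.InjOn γ (Metric.sphere (0:Plane) 1) ∧
    γ '' Metric.sphere (0:Plane) 1 = C

/-- A nowhere vanishing continuous complex function on a simply connected, locally path connected
space has a continuous logarithm. -/
theorem exists_continuous_log {A : Type*} [TopologicalSpace A] [SimplyConnectedSpace A]
    [LocallyPathConnectedSpace A] (g : A → ℂ) (hg : Continuous g) (h0 : ∀ a, g a ≠ 0) :
    ∃ l : A → ℂ, Continuous l ∧ ∀ a, Complex.exp (l a) = g a := by
  obtain ⟨a₀⟩ : Nonempty A := inferInstance
  obtain ⟨f, ⟨-, hf⟩, -⟩ := Complex.isCoveringMapOn_exp.existsUnique_continuousMap_lifts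
    (⟨g, hg⟩ : C(A, ℂ)) (a₀ := a₀) (Complex.exp_log (h0 a₀)) h0
  exact ⟨f, f.continuous, fun a => congrFun hf a⟩

/-- Two continuous logarithms of the same function on a preconnected space differ by a
constant. -/
theorem sub_eq_sub_of_exp_eq {A : Type*} [TopologicalSpace A] [PreconnectedSpace A]
    {l m : A → ℂ} (hl : Continuous l) (hm : Continuous m)
    (h : ∀ a, Complex.exp (l a) = Complex.exp (m a)) (a b : A) :
    l a - m a = l b - m b := by
  have hd : Continuous fun a => l a - m a := hl.sub hm
  choose n hn using fun a => Complex.exp_eq_exp_iff_exists_int.1 (h a)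
  have hn' : ∀ a, l a - m a = n a * (2 * Real.pi * Complex.I) := fun a => by rw [hn a]; ring
  have hpi : (2 * Real.pi * Complex.I : ℂ) ≠ 0 := Complex.two_pi_I_ne_zero
  have hc : Continuous fun a => ((n a : ℤ) : ℂ) := by
    have : (fun a => ((n a : ℤ) : ℂ)) = fun a => (l a - m a) / (2 * Real.pi * Complex.I) := by
      funext a
      rw [hn' a, mul_div_cancel_right₀ _ hpi]
    rw [this]
    exact hd.div_const _
  have hcz : Continuous n := by
    have hr : Continuous fun a => ((n a : ℤ) : ℝ) := by
      simpa [Function.comp_def] using Complex.continuous_re.comp hc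
    exact Int.isClosedEmbedding_coe_real.isEmbedding.continuous_iff.2 hr
  rw [hn', hn', PreconnectedSpace.constant ‹_› hcz]

/-- An orientation-preserving plane homeomorphism that exchanges two points has a fixed point. -/
theorem exists_fixed_of_swap (F : Plane ≃ₜ Plane) (hor : IsOrientationPreservingPlaneHomeo F)
    (hfree : ∀ x, F x ≠ x) (p q : Plane) (hpq : F p = q) (hqp : F q = p) : False := by
  obtain ⟨H, hc, h0, h1, hb⟩ := hor
  let c := Complex.orthonormalBasisOneI.repr.symm
  let τ : ℝ → ℝ := fun t => projIcc (0 : ℝ) 1 zero_le_one t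
  have hτ : Continuous τ := continuous_subtype_val.comp continuous_projIcc
  have hτ0 : τ 0 = 0 := by simp [τ]
  have hτ1 : τ 1 = 1 := by simp [τ]
  let E : ℝ × Plane → ℂ := fun z => c (H (τ z.1) (F z.2) - H (τ z.1) z.2)
  have hE : Continuous E := by
    refine c.continuous.comp (Continuous.sub ?_ ?_)
    · exact hc.comp ((hτ.comp continuous_fst).prodMk (F.continuous.comp continuous_snd))
    · exact hc.comp ((hτ.comp continuous_fst).prodMk continuous_snd)
  have hE0 : ∀ z, E z ≠ 0 := by
    intro z hz
    have h : H (τ z.1) (F z.2) - H (τ z.1) z.2 = 0 := c.map_eq_zero_iff.1 hz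
    exact hfree _ ((hb _ (projIcc (0 : ℝ) 1 zero_le_one z.1).2).injective (sub_eq_zero.1 h))
  obtain ⟨l, hl, hle⟩ := exists_continuous_log E hE hE0
  have hshift := sub_eq_sub_of_exp_eq (l := fun x => l (1, x)) (m := fun x => l (0, F x))
    (by fun_prop) (by fun_prop)
    (fun x => by simp [hle, E, hτ0, hτ1, h0, h1]) p q
  have hneg : ∀ t, E (t, q) = -E (t, p) := fun t => by
    simp only [E, hpq, hqp]
    rw [← map_neg, neg_sub]
  have hturn := sub_eq_sub_of_exp_eq (l := fun t : ℝ => l (t, q))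
    (m := fun t => l (t, p) + Real.pi * Complex.I) (by fun_prop) (by fun_prop)
    (fun t => by rw [Complex.exp_add, hle, hle, Complex.exp_pi_mul_I, hneg]; ring) 0 1
  simp only [hpq, hqp] at hshift
  have heq : l (0, p) = l (0, q) := by linear_combination (hshift - hturn) / 2
  have h2 : E (0, p) = E (0, q) := by rw [← hle, ← hle, heq]
  rw [hneg] at h2
  exact hE0 (0, p) (self_eq_neg.1 h2)

theorem IsOrientationPreservingPlaneHomeo.trans {F G : Plane ≃ₜ Plane}
    (hF : IsOrientationPreservingPlaneHomeo F) (hG : IsOrientationPreservingPlaneHomeo G) :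
    IsOrientationPreservingPlaneHomeo (F.trans G) := by
  obtain ⟨H, hc, h0, h1, hb⟩ := hF
  obtain ⟨K, kc, k0, k1, kb⟩ := hG
  refine ⟨fun t x => K t (H t x), kc.comp (continuous_fst.prodMk hc), fun x => by simp [h0, k0],
    fun x => by simp [h1, k1], fun t ht => (kb t ht).comp (hb t ht)⟩

/-- Moving each point by a strictly contracting multiple of a vector is a homeomorphism. -/
theorem exists_homeomorph_add_smul {β : Plane → ℝ} (hβ : LipschitzWith 1 β) {v : Plane}
    (hv : ‖v‖ < 1) : ∃ g : Plane ≃ₜ Plane, ∀ x, g x = x + β x • v := by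
  have happ : ApproximatesLinearOn (fun x => x + β x • v)
      ((ContinuousLinearEquiv.refl ℝ Plane : Plane ≃L[ℝ] Plane) : Plane →L[ℝ] Plane)
      univ ‖v‖₊ := by
    intro x _ y _
    have h : x + β x • v - (y + β y • v) - (x - y) = (β x - β y) • v := by
      rw [sub_smul]; abel
    have h2 : |β x - β y| ≤ ‖x - y‖ := by
      simpa [Real.dist_eq, dist_eq_norm] using hβ.dist_le_mul x y
    simp only [ContinuousLinearEquiv.coe_refl, ContinuousLinearMap.coe_id', id_eq]
    rw [h, norm_smul, Real.norm_eq_abs, coe_nnnorm, mul_comm]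
    gcongr
  have hN : Subsingleton Plane ∨ ‖v‖₊ <
      ‖(((ContinuousLinearEquiv.refl ℝ Plane).symm : Plane ≃L[ℝ] Plane) :
        Plane →L[ℝ] Plane)‖₊⁻¹ := by
    right
    have : ‖(((ContinuousLinearEquiv.refl ℝ Plane).symm : Plane ≃L[ℝ] Plane) :
        Plane →L[ℝ] Plane)‖₊ = 1 := by
      ext
      simp
    rw [this, inv_one]
    exact_mod_cast hv
  exact ⟨happ.toHomeomorph _ hN, fun x => rfl⟩

/-- A point of an open set can be moved to any sufficiently close point by a plane homeomorphism,
isotopic to the identity, that is supported in the set. -/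
theorem exists_push_of_dist_lt {U : Set Plane} {a b : Plane}
    (hab : dist b a < Metric.infDist a Uᶜ) :
    ∃ φ : Plane ≃ₜ Plane, IsOrientationPreservingPlaneHomeo φ ∧ (∀ x ∉ U, φ x = x) ∧ φ a = b := by
  set β : Plane → ℝ := fun x => Metric.infDist x Uᶜ with hβ
  have hβl : LipschitzWith 1 β := Metric.lipschitz_infDist_pt _
  have hpos : 0 < β a := dist_nonneg.trans_lt hab
  set v : Plane := (β a)⁻¹ • (b - a) with hv
  have hv1 : ‖v‖ < 1 := by
    rw [hv, norm_smul, norm_inv, Real.norm_of_nonneg hpos.le, ← dist_eq_norm,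
      inv_mul_lt_iff₀ hpos, mul_one]
    exact hab
  obtain ⟨φ, hφ⟩ := exists_homeomorph_add_smul hβl hv1
  refine ⟨φ, ⟨fun t x => x + β x • t • v, ?_, by simp, by simp [hφ], fun t ht => ?_⟩, ?_, ?_⟩
  · have := hβl.continuous
    fun_prop
  · have ht1 : ‖t • v‖ < 1 := by
      rw [norm_smul, Real.norm_of_nonneg ht.1]
      nlinarith [ht.1, ht.2, norm_nonneg v]
    obtain ⟨g, hg⟩ := exists_homeomorph_add_smul hβl ht1
    convert g.bijective using 1
    exact funext fun x => (hg x).symm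
  · intro x hx
    have : β x = 0 := Metric.infDist_zero_of_mem hx
    simp [hφ, this]
  · rw [hφ, hv, smul_smul, mul_inv_cancel₀ hpos.ne', one_smul, add_sub_cancel]

/-- Within an open proper subset of the plane, a point can be moved along a connected set by a
plane homeomorphism, isotopic to the identity, that is supported in the open set. -/
theorem exists_push {U K : Set Plane} (hU : IsOpen U) (hUc : Uᶜ.Nonempty) (hK : IsPreconnected K)
    (hKU : K ⊆ U) {a b : Plane} (ha : a ∈ K) (hb : b ∈ K) :
    ∃ φ : Plane ≃ₜ Plane, IsOrientationPreservingPlaneHomeo φ ∧ (∀ x ∉ U, φ x = x) ∧ φ a = b := by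
  refine hK.induction₂' (fun a b => ∃ φ : Plane ≃ₜ Plane, IsOrientationPreservingPlaneHomeo φ ∧
    (∀ x ∉ U, φ x = x) ∧ φ a = b) ?_ ?_ ha hb
  · intro x hx
    have hpos : 0 < Metric.infDist x Uᶜ :=
      (hU.isClosed_compl.notMem_iff_infDist_pos hUc).1 fun h => h (hKU hx)
    have hcont : Continuous fun y => Metric.infDist y Uᶜ := Metric.continuous_infDist_pt _
    have h1 : ∀ᶠ y in 𝓝 x, dist y x < Metric.infDist x Uᶜ :=
      (continuous_id.dist continuous_const).continuousAt.eventually_lt continuousAt_const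
        (by simpa using hpos)
    have h2 : ∀ᶠ y in 𝓝 x, dist x y < Metric.infDist y Uᶜ :=
      (continuous_const.dist continuous_id).continuousAt.eventually_lt hcont.continuousAt
        (by simpa using hpos)
    filter_upwards [nhdsWithin_le_nhds h1, nhdsWithin_le_nhds h2] with y hy1 hy2
    exact ⟨exists_push_of_dist_lt hy1, exists_push_of_dist_lt hy2⟩
  · rintro x y z - - - ⟨φ, hφ, hφU, hφx⟩ ⟨ψ, hψ, hψU, hψy⟩
    refine ⟨φ.trans ψ, hφ.trans hψ, fun w hw => ?_, ?_⟩
    · simp [hφU w hw, hψU w hw]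
    · simp [hφx, hψy]

/-- Following a homeomorphism by one supported in a free set creates no fixed points. -/
theorem trans_apply_ne_self {F φ : Plane ≃ₜ Plane} (hfree : ∀ x, F x ≠ x) {U : Set Plane}
    (hU : ∀ x ∈ U, F x ∉ U) (hφ : ∀ x ∉ U, φ x = x) (x : Plane) : (F.trans φ) x ≠ x := by
  rw [Homeomorph.trans_apply]
  intro h
  by_cases hx : F x ∈ U
  · have hx' : x ∉ U := fun h' => hU x h' hx
    have : φ (φ (F x)) = φ (F x) := hφ _ (by rwa [h])
    rw [φ.injective this] at h
    exact hfree x h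
  · rw [hφ _ hx] at h
    exact hfree x h

/-- An orbit segment that avoids the support of a perturbation is unchanged by it. -/
theorem iterate_trans_eq {F φ : Plane ≃ₜ Plane} {U : Set Plane} (hφ : ∀ x ∉ U, φ x = x)
    {w : Plane} {n : ℕ} (h : ∀ i, 0 < i → i < n → F^[i] w ∉ U) :
    ∀ i < n, (F.trans φ)^[i] w = F^[i] w := by
  intro i
  induction i with
  | zero => simp
  | succ i ih =>
    intro hi
    have := h (i + 1) i.succ_pos hi
    rw [Function.iterate_succ_apply', ih (by omega), Homeomorph.trans_apply,
      ← Function.iterate_succ_apply' F, hφ _ this]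

/-- No fixed-point-free orientation-preserving plane homeomorphism has a point fixed by its
`n`-th iterate. -/
def NoPeriod (n : ℕ) : Prop :=
  ∀ F : Plane ≃ₜ Plane, IsOrientationPreservingPlaneHomeo F → (∀ x, F x ≠ x) →
    ∀ p, F^[n] p ≠ p

/-- A free continuum that returns to itself produces a periodic point of a perturbation. -/
theorem NoPeriod.iterate_notMem {n : ℕ} (hn : ∀ m, 0 < m → m ≤ n → NoPeriod m)
    {F : Plane ≃ₜ Plane} (hor : IsOrientationPreservingPlaneHomeo F) (hfree : ∀ x, F x ≠ x)
    {K : Set Plane} (hK : IsCompact K) (hKc : IsPreconnected K) (hKF : ∀ x ∈ K, F x ∉ K)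
    {w : Plane} (hw : w ∈ K) {m : ℕ} (hm : 0 < m) (hmn : m ≤ n) : F^[m] w ∉ K := by
  classical
  intro hmem
  have hex : ∃ j, 0 < j ∧ F^[j] w ∈ K := ⟨m, hm, hmem⟩
  obtain ⟨hj0, hjK⟩ := Nat.find_spec hex
  have hjm : Nat.find hex ≤ m := Nat.find_min' hex ⟨hm, hmem⟩
  have hjmin : ∀ i, 0 < i → i < Nat.find hex → F^[i] w ∉ K :=
    fun i hi hij h => Nat.find_min hex hij ⟨hi, h⟩
  generalize Nat.find hex = j at hj0 hjK hjm hjmin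
  have hdisj : Disjoint K (F '' K) := by
    rw [Set.disjoint_left]
    rintro _ hx ⟨y, hy, rfl⟩
    exact hKF y hy hx
  obtain ⟨V, W, hV, hW, hKV, hKW, hVW⟩ := 
    SeparatedNhds.of_isCompact_isCompact hK (hK.image F.continuous) hdisj
  let O : Set Plane := (fun i => F^[i] w) '' Ioo 0 j
  have hO : IsClosed O := ((finite_Ioo 0 j).image _).isClosed
  let U : Set Plane := (V ∩ F ⁻¹' W) ∩ Oᶜ
  have hUo : IsOpen U := (hV.inter (hW.preimage F.continuous)).inter hO.isOpen_compl
  have hKU : K ⊆ U := by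
    refine fun x hx => ⟨⟨hKV hx, hKW (mem_image_of_mem F hx)⟩, ?_⟩
    rintro ⟨i, hi, rfl⟩
    exact hjmin i hi.1 hi.2 hx
  have hUF : ∀ x ∈ U, F x ∉ U := fun x hx hx' => Set.disjoint_left.1 hVW hx'.1.1 hx.1.2
  have hUO : ∀ i, 0 < i → i < j → F^[i] w ∉ U := fun i h1 h2 h => h.2 ⟨i, ⟨h1, h2⟩, rfl⟩
  obtain ⟨φ, hφor, hφ, hφw⟩ := exists_push hUo ⟨F w, hUF w (hKU hw)⟩ hKc hKU hjK hw
  refine hn j hj0 (hjm.trans hmn) (F.trans φ) (hor.trans hφor)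
    (trans_apply_ne_self hfree hUF hφ) w ?_
  obtain ⟨i, rfl⟩ := Nat.exists_eq_succ_of_ne_zero hj0.ne'
  rw [Function.iterate_succ_apply', iterate_trans_eq hφ hUO i (Nat.lt_succ_self i),
    Homeomorph.trans_apply, ← Function.iterate_succ_apply' F]
  exact hφw

/-- Every point is the centre of an open disc that is disjoint from the image of its closure and
whose boundary contains a point together with its image. -/
theorem exists_critical_disc (F : Plane ≃ₜ Plane) (hfree : ∀ x, F x ≠ x) (p : Plane) :
    ∃ (r : ℝ) (z : Plane), 0 < r ∧ dist z p = r ∧ dist (F z) p = r ∧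
      (∀ x ∈ Metric.closedBall p r, F x ∉ Metric.ball p r) ∧
      ∀ x ∈ Metric.ball p r, F x ∉ Metric.closedBall p r := by
  have hlim : Tendsto (fun x => max (dist x p) (dist (F x) p)) (cocompact Plane) atTop :=
    tendsto_atTop_mono (fun x => le_max_left _ _) (tendsto_dist_right_cocompact_atTop p)
  obtain ⟨z, hz⟩ := Continuous.exists_forall_le
    (f := fun x => max (dist x p) (dist (F x) p)) (by fun_prop) hlim
  set r := max (dist z p) (dist (F z) p) with hr
  have h1 : dist z p ≤ r := le_max_left _ _
  have h2 : dist (F z) p ≤ r := le_max_right _ _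
  have hpos : 0 < r := by
    by_contra h
    have hz1 : z = p := dist_le_zero.1 (h1.trans (not_lt.1 h))
    have hz2 : F z = p := dist_le_zero.1 (h2.trans (not_lt.1 h))
    exact hfree z (hz2.trans hz1.symm)
  have hball : ∀ x ∈ Metric.ball p r, F x ∉ Metric.ball p r := fun x hx hx' =>
    (hz x).not_gt (max_lt hx hx')
  have hcl : closure (Metric.ball p r) = Metric.closedBall p r := closure_ball p hpos.ne'
  have hin : ∀ x ∈ Metric.closedBall p r, F x ∉ Metric.ball p r := by
    intro x hx hx'
    rw [← hcl] at hx
    obtain ⟨y, hy, hyb⟩ := mem_closure_iff.1 hx (F ⁻¹' Metric.ball p r)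
      (Metric.isOpen_ball.preimage F.continuous) hx'
    exact hball y hyb hy
  have hout : ∀ x ∈ Metric.ball p r, F x ∉ Metric.closedBall p r := by
    intro x hx hx'
    rw [← hcl] at hx'
    obtain ⟨y, hy, hyb⟩ := mem_closure_iff.1 hx' (F.symm ⁻¹' Metric.ball p r)
      (Metric.isOpen_ball.preimage F.symm.continuous) (by simpa using hx)
    exact hball (F.symm y) hy (by simpa using hyb)
  refine ⟨r, z, hpos, h1.eq_of_not_lt fun h => hout z h h2,
    h2.eq_of_not_lt fun h => hin z h1 h, hin, hout⟩

/-- A segment from an interior point of a disc to a point of the closed disc stays in the open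
disc, except possibly at its endpoint. -/
theorem eq_or_mem_ball_of_mem_segment {p a b y : Plane} {r : ℝ} (ha : a ∈ Metric.ball p r)
    (hb : b ∈ Metric.closedBall p r) (hy : y ∈ segment ℝ a b) : y = b ∨ y ∈ Metric.ball p r := by
  have hr : r ≠ 0 := (Metric.pos_of_mem_ball ha).ne'
  rw [← insert_endpoints_openSegment] at hy
  rcases hy with rfl | rfl | hy
  · exact Or.inr ha
  · exact Or.inl rfl
  · right
    have := (convex_closedBall p r).openSegment_interior_self_subset_interior
      (by rwa [interior_closedBall p hr]) hb hy
    rwa [interior_closedBall p hr] at this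

/-- Two radii of a circle with distinct endpoints meet only at the centre. -/
theorem notMem_segment_midpoint {p z z' y : Plane} {r : ℝ} (hr : 0 < r) (hz : dist z p = r)
    (hz' : dist z' p = r) (hne : z ≠ z') (hy : y ∈ segment ℝ p z) :
    y ∉ segment ℝ (midpoint ℝ p z') z' := by
  intro hy'
  rw [segment_eq_image'] at hy hy'
  obtain ⟨s, ⟨hs0, hs1⟩, rfl⟩ := hy
  obtain ⟨t, ⟨ht0, ht1⟩, ht⟩ := hy'
  have hmid : midpoint ℝ p z' = p + (1 / 2 : ℝ) • (z' - p) := by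
    rw [midpoint_eq_smul_add, invOf_eq_inv]
    module
  have ht' : ((1 + t) / 2) • (z' - p) = s • (z - p) := by
    have h : midpoint ℝ p z' + t • (z' - midpoint ℝ p z') = p + ((1 + t) / 2) • (z' - p) := by
      rw [hmid]
      module
    exact add_left_cancel (h.symm.trans ht)
  have hnorm : (1 + t) / 2 = s := by
    have h := congrArg norm ht'
    rw [norm_smul, norm_smul, ← dist_eq_norm, ← dist_eq_norm, hz, hz', Real.norm_of_nonneg hs0,
      Real.norm_of_nonneg (by linarith)] at h
    exact mul_right_cancel₀ hr.ne' h
  rw [hnorm] at ht'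
  have hs : s ≠ 0 := by rw [← hnorm]; linarith
  exact hne (sub_left_injective (smul_right_injective _ hs ht')).symm

theorem isCompact_segment (a b : Plane) : IsCompact (segment ℝ a b) := by
  rw [segment_eq_image']
  exact isCompact_Icc.image (by fun_prop)

/-- A fixed-point-free orientation-preserving plane homeomorphism has no periodic points. -/
theorem noPeriod {n : ℕ} (hn : 0 < n) : NoPeriod n := by
  induction n using Nat.strong_induction_on with
  | _ n ih =>
  intro F hor hfree p hp
  obtain rfl | rfl | hn3 : n = 1 ∨ n = 2 ∨ 3 ≤ n := by omega
  · exact hfree p hp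
  · exact exists_fixed_of_swap F hor hfree p (F p) rfl hp
  have ih' : ∀ m, 0 < m → m ≤ n - 1 → NoPeriod m := fun m h1 h2 => ih m (by omega) h1
  obtain ⟨r, z, hr, hz, hFz, hin, hout⟩ := exists_critical_disc F hfree p
  have hsub : Metric.ball p r ⊆ Metric.closedBall p r := Metric.ball_subset_closedBall
  have hpB : p ∈ Metric.ball p r := Metric.mem_ball_self hr
  have hzc : z ∈ Metric.closedBall p r := hz.le
  have hFzc : F z ∈ Metric.closedBall p r := hFz.le
  have hBfree : ∀ x ∈ Metric.ball p r, F x ∉ Metric.ball p r := fun x hx => hin x (hsub hx)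
  have horbit : ∀ i, 0 < i → i < n → F^[i] p ∉ Metric.ball p r := by
    intro i hi hin' hmem
    have hs : segment ℝ p (F^[i] p) ⊆ Metric.ball p r := (convex_ball p r).segment_subset hpB hmem
    exact NoPeriod.iterate_notMem ih' hor hfree (isCompact_segment p (F^[i] p))
      (convex_segment p (F^[i] p)).isPreconnected (fun x hx hx' => hBfree x (hs hx) (hs hx'))
      (left_mem_segment ℝ _ _) hi (by omega) (right_mem_segment ℝ _ _)
  set v := midpoint ℝ p (F z) with hv
  have hvB : v ∈ Metric.ball p r := by
    rw [Metric.mem_ball, hv, dist_midpoint_left, dist_comm, hFz]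
    norm_num
    linarith
  obtain ⟨φ, hφor, hφ, hφp⟩ := exists_push Metric.isOpen_ball ⟨F p, hBfree p hpB⟩
    (convex_ball p r).isPreconnected subset_rfl hpB hvB
  have hGor := hor.trans hφor
  have hGfree := trans_apply_ne_self hfree hBfree hφ
  have hGF : ∀ x ∈ Metric.closedBall p r, (F.trans φ) x = F x := fun x hx => hφ _ (hin x hx)
  have hGn : (F.trans φ)^[n - 1] (F p) = v := by
    rw [← hGF p (hsub hpB), ← Function.iterate_succ_apply, Function.iterate_succ_apply',
      iterate_trans_eq hφ horbit (n - 1) (by omega), Homeomorph.trans_apply,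
      ← Function.iterate_succ_apply' F, Nat.succ_eq_add_one, Nat.sub_add_cancel hn, hp, hφp]
  generalize F.trans φ = G at hGor hGfree hGF hGn
  have hzp : ∀ y ∈ segment ℝ p z, y = z ∨ y ∈ Metric.ball p r := fun y hy =>
    eq_or_mem_ball_of_mem_segment hpB hzc hy
  have hzp' : ∀ y ∈ segment ℝ p z, y ∈ Metric.closedBall p r := fun y hy =>
    (convex_closedBall p r).segment_subset (hsub hpB) hzc hy
  have hdisj : ∀ y ∈ segment ℝ p z, y ∉ segment ℝ v (F z) := fun y hy =>
    notMem_segment_midpoint hr hz hFz (hfree z).symm hy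
  have hne : ∀ w ∈ segment ℝ p z, F w ≠ z := by
    intro w hw h
    rcases hzp w hw with rfl | hwB
    · exact hfree w h
    · exact hout w hwB (h ▸ hzc)
  have hne' : ∀ w ∈ segment ℝ p z, ∀ y, y = z ∨ y ∈ Metric.ball p r → F w ≠ y := by
    rintro w hw y (rfl | hy) h
    · exact hne w hw h
    · exact hin w (hzp' w hw) (h ▸ hy)
  have htwo : ∀ w ∈ segment ℝ p z, G (F w) ∉ Metric.ball p r := by
    intro w hw hmem
    have hs : segment ℝ p (G (F w)) ⊆ Metric.ball p r := (convex_ball p r).segment_subset hpB hmem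
    have hK : ∀ x ∈ segment ℝ p z ∪ segment ℝ p (G (F w)), x = z ∨ x ∈ Metric.ball p r := by
      rintro x (hx | hx)
      · exact hzp x hx
      · exact Or.inr (hs hx)
    refine NoPeriod.iterate_notMem (m := 2) ih' hGor hGfree
      ((isCompact_segment p z).union (isCompact_segment p (G (F w))))
      (IsPreconnected.union p (left_mem_segment ℝ _ _) (left_mem_segment ℝ _ _)
        (convex_segment p z).isPreconnected (convex_segment p (G (F w))).isPreconnected)
      ?_ (Or.inl hw) two_pos (by omega) ?_
    · intro x hx hx'
      rcases hK x hx with rfl | hxB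
      · rw [hGF _ hzc] at hx'
        exact hne' x (right_mem_segment ℝ _ _) _ (hK _ hx') rfl
      · rw [hGF _ (hsub hxB)] at hx'
        rcases hK _ hx' with h | h
        · exact hout x hxB (h ▸ hzc)
        · exact hBfree x hxB h
    · rw [show G^[2] w = G (G w) from rfl, hGF w (hzp' w hw)]
      exact Or.inr (right_mem_segment ℝ _ _)
  have hvF : ∀ y ∈ segment ℝ v (F z), y = F z ∨ y ∈ Metric.ball p r := fun y hy =>
    eq_or_mem_ball_of_mem_segment hvB hFzc hy
  have hvF' : ∀ y ∈ segment ℝ v (F z), y ∈ Metric.closedBall p r := fun y hy =>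
    (convex_closedBall p r).segment_subset (hsub hvB) hFzc hy
  refine NoPeriod.iterate_notMem (m := n - 1) (K := segment ℝ v (F z) ∪ F '' segment ℝ p z)
    (w := F p) ih' hGor hGfree
    ((isCompact_segment v (F z)).union ((isCompact_segment p z).image F.continuous))
    (IsPreconnected.union (F z) (right_mem_segment ℝ _ _)
      (mem_image_of_mem F (right_mem_segment ℝ _ _)) (convex_segment v (F z)).isPreconnected
      ((convex_segment p z).isPreconnected.image F F.continuous.continuousOn))
    ?_ (Or.inr (mem_image_of_mem F (left_mem_segment ℝ _ _))) (by omega) le_rfl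
    (hGn.symm ▸ Or.inl (left_mem_segment ℝ _ _))
  rintro x (hx | ⟨w, hw, rfl⟩) hx'
  · rw [hGF x (hvF' x hx)] at hx'
    rcases hx' with hx' | ⟨w, hw, hwx⟩
    · rcases hvF _ hx' with h | h
      · exact hdisj z (right_mem_segment ℝ _ _) (F.injective h ▸ hx)
      · exact hin x (hvF' x hx) h
    · exact hdisj w hw (F.injective hwx ▸ hx)
  · rcases hx' with hx' | ⟨w', hw', hww⟩
    · rcases hvF _ hx' with h | h
      · rw [← hGF z hzc] at h
        exact hne w hw (G.injective h)
      · exact htwo w hw h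
    · rw [← hGF w' (hzp' w' hw')] at hww
      exact hne' w hw w' (hzp w' hw') (G.injective hww).symm

/-- A fixed-point-free orientation-preserving homeomorphism of the
plane (a Brouwer homeomorphism) has no forward orbit with an accumulation point;
in particular it has no recurrent points. -/
theorem brouwer_no_accumulation (F : Plane ≃ₜ Plane)
    (hor : IsOrientationPreservingPlaneHomeo F)
    (hfree : ∀ x : Plane, F x ≠ x) :
    ∀ x : Plane, ¬ ∃ (y : Plane) (nk : ℕ → ℕ), StrictMono nk ∧
      Filter.Tendsto (fun k => (⇑F)^[nk k] x) Filter.atTop (nhds y) := by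
  rintro x ⟨y, nk, hnk, hlim⟩
  obtain ⟨V, W, hV, hW, hyV, hyW, hVW⟩ := t2_separation (hfree y).symm
  have hnhds : V ∩ F ⁻¹' W ∈ 𝓝 y := (hV.inter (hW.preimage F.continuous)).mem_nhds ⟨hyV, hyW⟩
  obtain ⟨δ, hδ, hball⟩ := Metric.nhds_basis_closedBall.mem_iff.1 hnhds
  obtain ⟨k, hk⟩ := (hlim.eventually (Metric.closedBall_mem_nhds y hδ)).exists_forall_of_atTop
  have hlt : nk k < nk (k + 1) := hnk k.lt_succ_self
  refine NoPeriod.iterate_notMem (fun m hm _ => noPeriod hm) hor hfree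
    (isCompact_closedBall y δ) (convex_closedBall y δ).isPreconnected
    (fun u hu hu' => Set.disjoint_left.1 hVW (hball hu').1 (hball hu).2)
    (hk k le_rfl) (Nat.sub_pos_of_lt hlt) le_rfl ?_
  rw [← Function.iterate_add_apply, Nat.sub_add_cancel hlt.le]
  exact hk (k + 1) k.le_succ
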